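/- Let A be a Banach algebra and φ ∈ Δ(A). If A is approximately amenable, then A is approximately left φ-biprojective. -/

import Mathlib

open Filter Topology

universe u

/-! ## Nets indexed by directed sets -/

/-- A (nonempty) directed index type, used to index nets. -/
structure DirSys : Type (u + 1) where
  ι : Type u
  [pre : Preorder ι]
  [dir : IsDirected ι (· ≤ ·)]
  [ne : Nonempty ι]

attribute [instance] DirSys.pre DirSys.dir DirSys.ne

section Core

variable (A : Type u) [NonUnitalNormedRing A] [NormedSpace ℂ A]
  [IsScalarTower ℂ A A] [SMulCommClass ℂ A A]

/-- A realization of the projective tensor product `A ⊗̂ A` of a Banach algebra `A` with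
itself, together with its canonical Banach `A`-bimodule structure and the product
(diagonal) map `π_A`.  The field `universal` is the universal property of the projective
tensor norm, which pins the object down uniquely up to isometric isomorphism. -/
structure ProjTensorSq (X : Type u) [NormedAddCommGroup X] [NormedSpace ℂ X]
    [CompleteSpace X] : Type (u + 1) where
  /-- the canonical bilinear map `(a, b) ↦ a ⊗ b` -/
  tmul : A →L[ℂ] A →L[ℂ] X
  /-- the projective norm is a cross norm -/
  norm_tmul : ∀ a b : A, ‖tmul a b‖ = ‖a‖ * ‖b‖
  /-- elementary tensors span a dense subspace -/
  dense_span : Dense (Submodule.span ℂ (Set.range fun p : A × A => tmul p.1 p.2) : Set X)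
  /-- the universal property of the projective tensor product -/
  universal : ∀ (Y : Type u) [NormedAddCommGroup Y] [NormedSpace ℂ Y] [CompleteSpace Y]
      (f : A →L[ℂ] A →L[ℂ] Y), ∃ g : X →L[ℂ] Y, ‖g‖ ≤ ‖f‖ ∧ ∀ a b : A, g (tmul a b) = f a b
  /-- the left module action `a · (b ⊗ c) = (a * b) ⊗ c` -/
  lsmul : A →L[ℂ] X →L[ℂ] X
  lsmul_tmul : ∀ a b c : A, lsmul a (tmul b c) = tmul (a * b) c
  /-- the right module action `(b ⊗ c) · a = b ⊗ (c * a)` -/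
  rsmul : A →L[ℂ] X →L[ℂ] X
  rsmul_tmul : ∀ a b c : A, rsmul a (tmul b c) = tmul b (c * a)
  /-- the product map `π_A`, determined by `π_A (a ⊗ b) = a * b` -/
  projL : X →L[ℂ] A
  projL_tmul : ∀ a b : A, projL (tmul a b) = a * b

variable {A}

/-- `A` is approximately left `φ`-biprojective:  there is a net `(ρ_α)` of bounded linear
maps `A → A ⊗̂ A` with `a·ρ_α(x) - ρ_α(ax) → 0`, `ρ_α(xa) - φ(a)ρ_α(x) → 0` and
`φ(π_A(ρ_α(x))) → φ(x)` for all `a x : A`. -/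
def ApproxLeftBiprojective (φ : WeakDual.characterSpace ℂ A) : Prop :=
  ∀ (X : Type u) [NormedAddCommGroup X] [NormedSpace ℂ X] [CompleteSpace X]
    (P : ProjTensorSq A X),
    ∃ (D : DirSys.{u}) (ρ : D.ι → (A →L[ℂ] X)),
      (∀ a x : A, Tendsto (fun i => P.lsmul a (ρ i x) - ρ i (a * x)) atTop (𝓝 0)) ∧
      (∀ a x : A, Tendsto (fun i => ρ i (x * a) - φ a • ρ i x) atTop (𝓝 0)) ∧
      (∀ x : A, Tendsto (fun i => φ (P.projL (ρ i x))) atTop (𝓝 (φ x)))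

/-- `A` is approximately left character biprojective if it is approximately left
`φ`-biprojective for every character `φ` of `A`. -/
def ApproxLeftCharBiprojective : Prop :=
  ∀ φ : WeakDual.characterSpace ℂ A, ApproxLeftBiprojective φ

/-- `A` is approximately left `φ`-amenable: there is a (not necessarily bounded) net
`(a_α)` in `A` with `‖a * a_α - φ(a) a_α‖ → 0` for every `a` and `φ(a_α) → 1`. -/
def ApproxLeftAmenable (φ : WeakDual.characterSpace ℂ A) : Prop :=
  ∃ (D : DirSys.{u}) (v : D.ι → A),
    (∀ a : A, Tendsto (fun i => a * v i - φ a • v i) atTop (𝓝 0)) ∧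
    Tendsto (fun i => φ (v i)) atTop (𝓝 1)

/-- `A` is approximately biprojective (Zhang): there is a net `(ρ_α)` of bounded
`A`-bimodule morphisms `A → A ⊗̂ A` with `π_A(ρ_α(a)) → a` for every `a`. -/
def ApproxBiprojective : Prop :=
  ∀ (X : Type u) [NormedAddCommGroup X] [NormedSpace ℂ X] [CompleteSpace X]
    (P : ProjTensorSq A X),
    ∃ (D : DirSys.{u}) (ρ : D.ι → (A →L[ℂ] X)),
      (∀ i, ∀ a b : A, ρ i (a * b) = P.lsmul a (ρ i b)) ∧
      (∀ i, ∀ a b : A, ρ i (a * b) = P.rsmul b (ρ i a)) ∧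
      (∀ a : A, Tendsto (fun i => P.projL (ρ i a)) atTop (𝓝 a))

/-- `A` is pseudo-amenable: there is a (not necessarily bounded) net `(m_α)` in `A ⊗̂ A`
with `a·m_α - m_α·a → 0` and `π_A(m_α) a → a` for every `a`. -/
def PseudoAmenable : Prop :=
  ∀ (X : Type u) [NormedAddCommGroup X] [NormedSpace ℂ X] [CompleteSpace X]
    (P : ProjTensorSq A X),
    ∃ (D : DirSys.{u}) (m : D.ι → X),
      (∀ a : A, Tendsto (fun i => P.lsmul a (m i) - P.rsmul a (m i)) atTop (𝓝 0)) ∧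
      (∀ a : A, Tendsto (fun i => P.projL (m i) * a - a) atTop (𝓝 0))

end Core

section ApproxAmenable

variable (A : Type u) [NonUnitalNormedRing A] [NormedSpace ℂ A]
  [IsScalarTower ℂ A A] [SMulCommClass ℂ A A]

/-- A Banach `A`-bimodule structure on a Banach space `X`: contractive commuting left and
right actions of `A` on `X`. -/
structure BanachBimodule (X : Type u) [NormedAddCommGroup X] [NormedSpace ℂ X]
    [CompleteSpace X] : Type u where
  /-- the left action -/
  l : A →L[ℂ] X →L[ℂ] X
  /-- the right action -/
  r : A →L[ℂ] X →L[ℂ] X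
  l_mul : ∀ (a b : A) (x : X), l (a * b) x = l a (l b x)
  r_mul : ∀ (a b : A) (x : X), r (a * b) x = r b (r a x)
  lr_comm : ∀ (a b : A) (x : X), l a (r b x) = r b (l a x)
  norm_l : ∀ (a : A) (x : X), ‖l a x‖ ≤ ‖a‖ * ‖x‖
  norm_r : ∀ (a : A) (x : X), ‖r a x‖ ≤ ‖a‖ * ‖x‖

variable {A}

/-- `A` is approximately amenable (Ghahramani–Loy): for every Banach `A`-bimodule `X` and
every continuous derivation `D : A → X*` (where `X*` carries the dual bimodule actions
`(a·f)(x) = f(x·a)` and `(f·a)(x) = f(a·x)`), there is a net `(ξ_α)` in `X*` with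
`D(a) = lim_α (a·ξ_α - ξ_α·a)` for every `a ∈ A`. -/
def ApproxAmenable : Prop :=
  ∀ (X : Type u) [NormedAddCommGroup X] [NormedSpace ℂ X] [CompleteSpace X]
    (M : BanachBimodule A X) (D : A →L[ℂ] (X →L[ℂ] ℂ)),
    (∀ a b : A, D (a * b) = (D b).comp (M.r a) + (D a).comp (M.l b)) →
    ∃ (Dn : DirSys.{u}) (ξ : Dn.ι → (X →L[ℂ] ℂ)),
      ∀ a : A, Tendsto (fun i => (ξ i).comp (M.r a) - (ξ i).comp (M.l a)) atTop (𝓝 (D a))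

end ApproxAmenable

/-- A point outside the closure of a subspace is separated from it by a functional. -/
theorem exists_continuousLinearMap_vanishing_of_notMem_closure {E : Type*} [NormedAddCommGroup E]
    [NormedSpace ℂ E] (S : Submodule ℂ E) {w : E} (hw : w ∉ closure (S : Set E)) :
    ∃ g : E →L[ℂ] ℂ, (∀ x ∈ S, g x = 0) ∧ g w ≠ 0 := by
  have hw' : w ∉ S.topologicalClosure := hw
  have : IsClosed (S.topologicalClosure : Set E) := S.isClosed_topologicalClosure
  have hne : S.topologicalClosure.mkQL w ≠ 0 := by
    simpa [Submodule.Quotient.mk_eq_zero] using hw'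
  obtain ⟨g, -, hg⟩ := exists_dual_vector ℂ (S.topologicalClosure.mkQL w) (norm_ne_zero_iff.2 hne)
  refine ⟨g.comp S.topologicalClosure.mkQL, fun x hx => ?_, ?_⟩
  · have hx0 : S.topologicalClosure.mkQL x = 0 := by
      simpa [Submodule.Quotient.mk_eq_zero] using S.le_topologicalClosure hx
    rw [ContinuousLinearMap.comp_apply, hx0, map_zero]
  · rw [ContinuousLinearMap.comp_apply, hg]
    exact Complex.ofReal_ne_zero.2 (norm_ne_zero_iff.2 hne)

section CharacterKernel

variable {A : Type u} [NonUnitalNormedRing A] [NormedSpace ℂ A] (φ : WeakDual.characterSpace ℂ A)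

/-- A continuous character of a normed algebra is contractive. -/
theorem norm_character_apply_le (a : A) : ‖φ a‖ ≤ ‖a‖ := by
  set f : A →L[ℂ] ℂ := WeakDual.CharacterSpace.toCLM φ with hf
  have hfa : ∀ x, f x = φ x := fun _ => rfl
  have hsq : ∀ x, ‖f x‖ ≤ √‖f‖ * ‖x‖ := fun x => by
    refine (sq_le_sq₀ (norm_nonneg _) (by positivity)).1 ?_
    calc ‖f x‖ ^ 2 = ‖f (x * x)‖ := by simp only [hfa, map_mul, norm_mul, sq]
      _ ≤ ‖f‖ * ‖x * x‖ := f.le_opNorm _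
      _ ≤ ‖f‖ * (‖x‖ * ‖x‖) := by gcongr; exact norm_mul_le x x
      _ = (√‖f‖ * ‖x‖) ^ 2 := by rw [mul_pow, Real.sq_sqrt (norm_nonneg _)]; ring
  have h1 : ‖f‖ ≤ √‖f‖ := f.opNorm_le_bound (Real.sqrt_nonneg _) hsq
  have h2 : √‖f‖ ≤ 1 := by
    nlinarith [Real.sq_sqrt (norm_nonneg f), Real.sqrt_nonneg ‖f‖]
  exact (hsq a).trans (mul_le_of_le_one_left (norm_nonneg _) h2)

/-- The kernel of a character, as a closed subspace. -/
noncomputable abbrev characterKer : Submodule ℂ A :=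
  LinearMap.ker ((WeakDual.CharacterSpace.toCLM φ : A →L[ℂ] ℂ) : A →ₗ[ℂ] ℂ)

theorem mem_characterKer {x : A} : x ∈ characterKer φ ↔ φ x = 0 := Iff.rfl

variable [IsScalarTower ℂ A A] [SMulCommClass ℂ A A]

/-- The action of `A` by left multiplication on the kernel of a character. -/
noncomputable def characterKerMul : A →L[ℂ] characterKer φ →L[ℂ] characterKer φ :=
  LinearMap.mkContinuous₂
    (LinearMap.mk₂ ℂ
      (fun (a : A) (k : characterKer φ) => (⟨a * k, by
        rw [mem_characterKer, map_mul, (mem_characterKer φ).1 k.2, mul_zero]⟩ : characterKer φ))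
      (fun _ _ _ => Subtype.ext (add_mul _ _ _))
      (fun _ _ _ => Subtype.ext (smul_mul_assoc _ _ _))
      (fun _ _ _ => Subtype.ext (mul_add _ _ _))
      (fun _ _ _ => Subtype.ext (mul_smul_comm _ _ _))) 1
    (fun a k => by rw [one_mul]; exact norm_mul_le a (k : A))

@[simp]
theorem coe_characterKerMul (a : A) (k : characterKer φ) :
    (characterKerMul φ a k : A) = a * k := rfl

theorem norm_characterKerMul_le (a : A) : ‖characterKerMul φ a‖ ≤ ‖a‖ :=
  ContinuousLinearMap.opNorm_le_bound _ (norm_nonneg a) fun k => norm_mul_le a (k : A)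

/-- The map `a ↦ (v ↦ a * v - φ a • v)`. -/
noncomputable def characterDefect : A →L[ℂ] A →L[ℂ] A :=
  ContinuousLinearMap.mul ℂ A -
    (WeakDual.CharacterSpace.toCLM φ : A →L[ℂ] ℂ).smulRight (ContinuousLinearMap.id ℂ A)

@[simp]
theorem characterDefect_apply (a v : A) : characterDefect φ a v = a * v - φ a • v := rfl

theorem characterDefect_mem (a v : A) : characterDefect φ a v ∈ characterKer φ := by
  rw [mem_characterKer, characterDefect_apply, map_sub, map_mul, map_smul, smul_eq_mul, sub_self]

/-- The map `a ↦ a * v - φ a • v`, with values in the kernel of `φ`. -/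
noncomputable def characterDefectKer (v : A) : A →L[ℂ] characterKer φ :=
  ((characterDefect φ).flip v).codRestrict (characterKer φ) fun a => characterDefect_mem φ a v

@[simp]
theorem coe_characterDefectKer (v a : A) : (characterDefectKer φ v a : A) = a * v - φ a • v := rfl

/-- The dual of the kernel of `φ`, with right action dual to left multiplication and left action
through `φ`. -/
noncomputable def characterKerDualBimodule :
    BanachBimodule A (characterKer φ →L[ℂ] ℂ) where
  l := (WeakDual.CharacterSpace.toCLM φ : A →L[ℂ] ℂ).smulRight (ContinuousLinearMap.id ℂ _)
  r := (ContinuousLinearMap.compL ℂ (characterKer φ) (characterKer φ) ℂ).flip.comp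
    (characterKerMul φ)
  l_mul a b x := by
    change φ (a * b) • x = φ a • φ b • x
    rw [map_mul, mul_smul]
  r_mul a b x := by
    refine ContinuousLinearMap.ext fun k => congrArg x (Subtype.ext ?_)
    exact mul_assoc a b (k : A)
  lr_comm _ _ _ := rfl
  norm_l a x := by
    change ‖φ a • x‖ ≤ _
    exact (x.opNorm_smul_le (φ a)).trans
      (mul_le_mul_of_nonneg_right (norm_character_apply_le φ a) (norm_nonneg x))
  norm_r a x := by
    change ‖x.comp (characterKerMul φ a)‖ ≤ _
    rw [mul_comm]
    exact (x.opNorm_comp_le _).trans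
      (mul_le_mul_of_nonneg_left (norm_characterKerMul_le φ a) (norm_nonneg x))

theorem characterKerDualBimodule_l (a : A) (f : characterKer φ →L[ℂ] ℂ) :
    (characterKerDualBimodule φ).l a f = φ a • f := rfl

theorem characterKerDualBimodule_r (a : A) (f : characterKer φ →L[ℂ] ℂ) :
    (characterKerDualBimodule φ).r a f = f.comp (characterKerMul φ a) := rfl

variable {φ}

/-- Approximate amenability yields functionals on `(ker φ)*` asymptotically implementing the
derivation `a ↦ a * v - φ a • v`, tested against elements of `(ker φ)*`. -/
theorem ApproxAmenable.exists_net_characterKer (haa : ApproxAmenable (A := A)) (v : A) :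
    ∃ (D : DirSys.{u}) (ξ : D.ι → ((characterKer φ →L[ℂ] ℂ) →L[ℂ] ℂ)),
      ∀ (a : A) (f : characterKer φ →L[ℂ] ℂ),
        Tendsto (fun i => ξ i (f.comp (characterKerMul φ a) - φ a • f)) atTop
          (𝓝 (f (characterDefectKer φ v a))) := by
  obtain ⟨D, ξ, hξ⟩ := haa (characterKer φ →L[ℂ] ℂ) (characterKerDualBimodule φ)
    ((ContinuousLinearMap.apply ℂ ℂ).comp (characterDefectKer φ v)) (fun a b => by
      refine ContinuousLinearMap.ext fun f => ?_
      change f (characterDefectKer φ v (a * b)) =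
        f (characterKerMul φ a (characterDefectKer φ v b)) + φ b • f (characterDefectKer φ v a)
      rw [← map_smul, ← map_add]
      refine congrArg f (Subtype.ext ?_)
      simp only [Submodule.coe_add, Submodule.coe_smul, coe_characterDefectKer,
        coe_characterKerMul, map_mul, mul_sub, smul_sub, mul_smul_comm, mul_assoc, smul_smul,
        mul_comm (φ b)]
      abel)
  refine ⟨D, ξ, fun a f => ?_⟩
  have h := ((ContinuousLinearMap.apply ℂ ℂ f).continuous.tendsto _).comp (hξ a)
  refine h.congr fun i => ?_
  rw [map_sub]
  rfl

/-- In an approximately amenable algebra, every character `φ` admits almost `φ`-invariant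
elements on which `φ` is `1`. -/
theorem ApproxAmenable.exists_almost_invariant (haa : ApproxAmenable (A := A)) {v₀ : A}
    (hv₀ : φ v₀ = 1) (F : Finset A) {ε : ℝ} (hε : 0 < ε) :
    ∃ v : A, φ v = 1 ∧ ∀ a ∈ F, ‖a * v - φ a • v‖ < ε := by
  classical
  let T : A →L[ℂ] (F → A) := ContinuousLinearMap.pi fun a => characterDefect φ a
  have hT : ∀ v a, T v a = a * v - φ a • v := fun _ _ => rfl
  let S : Submodule ℂ (F → A) := (characterKer φ).map (T : A →ₗ[ℂ] (F → A))
  have hmem : T v₀ ∈ closure (S : Set (F → A)) := by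
    by_contra hw
    obtain ⟨g, hgS, hgw⟩ := exists_continuousLinearMap_vanishing_of_notMem_closure S hw
    let f : F → (characterKer φ →L[ℂ] ℂ) := fun a =>
      (g.comp (ContinuousLinearMap.single ℂ (fun _ : F => A) a)).comp (characterKer φ).subtypeL
    have hf : ∀ a k, f a k = g (Pi.single a (k : A)) := fun _ _ => rfl
    have hg : ∀ w : F → A, g w = ∑ a, g (Pi.single a (w a)) := fun w => by
      rw [← map_sum, Finset.univ_sum_single]
    obtain ⟨D, ξ, hξ⟩ := haa.exists_net_characterKer (φ := φ) v₀
    have hlim := tendsto_finsetSum Finset.univ fun (a : F) _ => hξ a (f a)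
    have hzero : ∑ a : F, ((f a).comp (characterKerMul φ (a : A)) - φ (a : A) • f a) = 0 := by
      refine ContinuousLinearMap.ext fun k => ?_
      have hk := hgS (T k) (Submodule.mem_map_of_mem k.2)
      rw [hg] at hk
      rw [sum_apply, zero_apply, ← hk]
      refine Finset.sum_congr rfl fun a _ => ?_
      rw [sub_apply, smul_apply,
        ContinuousLinearMap.comp_apply, ← map_smul, ← map_sub, hf]
      rfl
    have hval : ∑ a : F, f a (characterDefectKer φ v₀ a) = g (T v₀) := by
      rw [hg]
      rfl
    simp only [← map_sum, hzero, map_zero, hval] at hlim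
    exact hgw (tendsto_nhds_unique hlim tendsto_const_nhds)
  obtain ⟨_, ⟨k, hk, rfl⟩, hdist⟩ := Metric.mem_closure_iff.1 hmem ε hε
  refine ⟨v₀ - k, ?_, fun a ha => ?_⟩
  · rw [map_sub, hv₀, (mem_characterKer φ).1 hk, sub_zero]
  · have h : ‖T (v₀ - k)‖ < ε := by
      rw [map_sub, ← dist_eq_norm]
      exact hdist
    exact (norm_le_pi_norm (T (v₀ - k)) ⟨a, ha⟩).trans_lt h

/-- An approximately amenable algebra is approximately left `φ`-amenable, through elements on
which `φ` is `1`. -/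
theorem ApproxAmenable.exists_net_almost_invariant (haa : ApproxAmenable (A := A)) {v₀ : A}
    (hv₀ : φ v₀ = 1) :
    ∃ (D : DirSys.{u}) (v : D.ι → A), (∀ i, φ (v i) = 1) ∧
      ∀ a : A, Tendsto (fun i => a * v i - φ a • v i) atTop (𝓝 0) := by
  classical
  choose v hv hva using fun i : Finset A × ℕ =>
    haa.exists_almost_invariant hv₀ i.1 (Nat.one_div_pos_of_nat (α := ℝ) (n := i.2))
  refine ⟨⟨Finset A × ℕ⟩, v, hv, fun a => ?_⟩
  rw [Metric.tendsto_atTop]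
  intro ε hε
  obtain ⟨n, hn⟩ := exists_nat_one_div_lt hε
  refine ⟨({a}, n), fun i hi => ?_⟩
  rw [dist_zero_right]
  exact ((hva i a (hi.1 (Finset.mem_singleton_self a))).trans_le
    (Nat.one_div_le_one_div hi.2)).trans hn

end CharacterKernel

/-- Remark 2.5, second half.  Let `A` be a Banach algebra and
`φ ∈ Δ(A)`.  If `A` is approximately amenable, then `A` is approximately left
`φ`-biprojective. -/
theorem approxAmenable_implies_approxLeftBiprojective
    {A : Type u} [NonUnitalNormedRing A] [NormedSpace ℂ A]
    [IsScalarTower ℂ A A] [SMulCommClass ℂ A A] [CompleteSpace A]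
    (φ : WeakDual.characterSpace ℂ A)
    (haa : ApproxAmenable (A := A)) :
    ApproxLeftBiprojective φ := by
  intro X _ _ _ P
  obtain ⟨v₀, hv₀⟩ : ∃ v₀, φ v₀ = 1 := by
    obtain ⟨x, hx⟩ : ∃ x, φ x ≠ 0 := by
      by_contra! h
      exact φ.2.1 (ContinuousLinearMap.ext h)
    exact ⟨(φ x)⁻¹ • x, by rw [map_smul, smul_eq_mul, inv_mul_cancel₀ hx]⟩
  obtain ⟨D, v, hv, hva⟩ := haa.exists_net_almost_invariant hv₀
  refine ⟨D, fun i => (WeakDual.CharacterSpace.toCLM φ : A →L[ℂ] ℂ).smulRight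
    (P.tmul (v i) v₀), fun a y => ?_, fun a y => ?_, fun y => ?_⟩
  · have h := (((φ y • P.tmul.flip v₀).continuous.tendsto 0).comp (hva a))
    rw [map_zero] at h
    refine h.congr fun i => ?_
    change φ y • P.tmul (a * v i - φ a • v i) v₀ =
      P.lsmul a (φ y • P.tmul (v i) v₀) - φ (a * y) • P.tmul (v i) v₀
    rw [map_smul, P.lsmul_tmul, map_mul φ, map_sub, map_smul, sub_apply,
      smul_apply, smul_sub, smul_smul, mul_comm]
  · refine tendsto_const_nhds.congr fun i => ?_
    change 0 = φ (y * a) • P.tmul (v i) v₀ - φ a • φ y • P.tmul (v i) v₀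
    rw [map_mul, smul_smul, mul_comm, sub_self]
  · refine tendsto_const_nhds.congr fun i => ?_
    change φ y = φ (P.projL (φ y • P.tmul (v i) v₀))
    rw [map_smul, P.projL_tmul, map_smul, map_mul, hv, hv₀, mul_one, smul_eq_mul, mul_one]
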